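/- For every 2-wave word ω over Σ, the graph of ω has treewidth at most 11. -/

import Mathlib

/-- A matching relation of length `n`, on positions `1, …, n`. -/
structure Matching (n : ℕ) where
  rel : ℕ → ℕ → Prop
  ordered : ∀ i j, rel i j → 1 ≤ i ∧ i < j ∧ j ≤ n
  unique : ∀ i j k l, rel i j → rel k l →
    (i = k ∨ i = l ∨ j = k ∨ j = l) → i = k ∧ j = l
  noncrossing : ∀ i j k l, rel i j → rel k l → i < k → k < j → l < j

/-- A 2-nested word: a word together with two matchings of its length. -/
structure TwoNW (α : Type) where
  word : List α
  M1 : Matching word.length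
  M2 : Matching word.length

def Matching.IsCall {n : ℕ} (M : Matching n) (i : ℕ) : Prop := ∃ j, M.rel i j
def Matching.IsRet {n : ℕ} (M : Matching n) (i : ℕ) : Prop := ∃ j, M.rel j i
def Matching.IsInt {n : ℕ} (M : Matching n) (i : ℕ) : Prop := ¬ M.IsCall i ∧ ¬ M.IsRet i

/-- `(i1,i2,i3,i4)` is a 2-wave of the pair of matchings `(M1, M2)`. -/
def IsTwoWaveQuad {n : ℕ} (M1 M2 : Matching n) (i1 i2 i3 i4 : ℕ) : Prop :=
  i1 < i2 ∧ i2 < i3 ∧ i3 < i4 ∧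
  M1.rel i1 i2 ∧ M1.rel i3 i4 ∧ M2.rel i2 i3 ∧ M2.rel i1 i4

/-- A 2-wave structure: every arch of `M1 ∪ M2` is an arch of some 2-wave. -/
def IsWaveStructure {n : ℕ} (M1 M2 : Matching n) : Prop :=
  (∀ i j, M1.rel i j → ∃ i1 i2 i3 i4, IsTwoWaveQuad M1 M2 i1 i2 i3 i4 ∧
      ((i = i1 ∧ j = i2) ∨ (i = i3 ∧ j = i4))) ∧
  (∀ i j, M2.rel i j → ∃ i1 i2 i3 i4, IsTwoWaveQuad M1 M2 i1 i2 i3 i4 ∧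
      ((i = i2 ∧ j = i3) ∨ (i = i1 ∧ j = i4)))

/-- A 2-wave word. -/
def TwoNW.IsWaveWord {α : Type} (ω : TwoNW α) : Prop := IsWaveStructure ω.M1 ω.M2

/-- The graph of a 2-nested word: vertices are positions `1, …, n`, edges are
the arches of both matchings plus the successor edges. -/
def TwoNW.Adj {α : Type} (ω : TwoNW α) (i j : ℕ) : Prop :=
  ω.M1.rel i j ∨ ω.M1.rel j i ∨ ω.M2.rel i j ∨ ω.M2.rel j i ∨
  (1 ≤ i ∧ j = i + 1 ∧ j ≤ ω.word.length) ∨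
  (1 ≤ j ∧ i = j + 1 ∧ i ≤ ω.word.length)

/-- The graph with vertex set `V ⊆ ℕ` and edge relation `E` has treewidth at
most `k`: it admits a tree decomposition all of whose bags have at most `k+1`
vertices. -/
def HasTreewidthLE (V : Set ℕ) (E : ℕ → ℕ → Prop) (k : ℕ) : Prop :=
  ∃ (T : Type) (t : SimpleGraph T), t.IsTree ∧ ∃ bag : T → Finset ℕ,
    (∀ v ∈ V, ∃ x, v ∈ bag x) ∧
    (∀ i j, E i j → ∃ x, i ∈ bag x ∧ j ∈ bag x) ∧
    (∀ (v : ℕ) (x y : T) (p : t.Walk x y), p.IsPath → v ∈ bag x → v ∈ bag y →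
      ∀ z ∈ p.support, v ∈ bag z) ∧
    (∀ x, (bag x).card ≤ k + 1)

namespace SimpleGraph

variable {V W : Type*} {G : SimpleGraph V} {H : SimpleGraph W}

theorem isBridge_sum_inl {v w : V} (h : G.IsBridge s(v, w)) :
    (G ⊕g H).IsBridge s(Sum.inl v, Sum.inl w) := by
  rw [isBridge_iff] at h ⊢
  have key : ∀ {x y : V ⊕ W}
      (_ : ((G ⊕g H).deleteEdges {s(Sum.inl v, Sum.inl w)}).Walk x y) (u : V), x = Sum.inl u →
      ∃ u', y = Sum.inl u' ∧ (G.deleteEdges {s(v, w)}).Reachable u u' := by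
    intro x y p
    induction p with
    | nil => exact fun u hu => ⟨u, hu, .rfl⟩
    | @cons x z y hxz p ih =>
      rintro u rfl
      rcases z with z | z
      · obtain ⟨u', hu', hr⟩ := ih z rfl
        refine ⟨u', hu', Reachable.trans (Adj.reachable ?_) hr⟩
        simpa [deleteEdges_adj] using hxz
      · simp [deleteEdges_adj] at hxz
  rintro ⟨p⟩
  obtain ⟨u', hu', hr⟩ := key p v rfl
  obtain rfl := Sum.inl_injective hu'
  exact h hr

theorem IsAcyclic.sum (hG : G.IsAcyclic) (hH : H.IsAcyclic) : (G ⊕g H).IsAcyclic := by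
  rw [isAcyclic_iff_forall_adj_isBridge] at hG ⊢
  rintro (v | v) (w | w) h
  · exact isBridge_sum_inl (hG (by simpa using h))
  · simp at h
  · simp at h
  · have hb : (H ⊕g G).IsBridge s(Sum.inl v, Sum.inl w) :=
      isBridge_sum_inl (isAcyclic_iff_forall_adj_isBridge.1 hH (by simpa using h))
    rw [isBridge_iff] at hb ⊢
    intro hr
    refine hb (hr.map (⟨Sum.swap, ?_⟩ : _ →g _))
    rintro (x | x) (y | y) hxy <;> simp_all [deleteEdges_adj]

theorem IsTree.sum_sup_edge (hG : G.IsTree) (hH : H.IsTree) (v : V) (w : W) :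
    ((G ⊕g H) ⊔ edge (Sum.inl v) (Sum.inr w)).IsTree :=
  ⟨hG.connected.sum_sup_edge hH.connected,
    (hG.isAcyclic.sum hH.isAcyclic).sup_edge_of_not_reachable (not_reachable_sum_inl_inr v w)⟩

/-- Two trees can be joined into one tree by an edge between prescribed vertices. -/
theorem IsTree.exists_join (hG : G.IsTree) (hH : H.IsTree) (v : V) (w : W) :
    ∃ (K : SimpleGraph (V ⊕ W)) (f : G →g K) (g : H →g K), K.IsTree ∧
      (∀ x, f x = Sum.inl x) ∧ (∀ x, g x = Sum.inr x) ∧ K.Adj (Sum.inl v) (Sum.inr w) :=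
  ⟨_, (Hom.ofLE le_sup_left).comp Embedding.sumInl.toHom,
    (Hom.ofLE le_sup_left).comp Embedding.sumInr.toHom, hG.sum_sup_edge hH v w,
    fun _ => rfl, fun _ => rfl, by simp [edge_adj]⟩

end SimpleGraph

/-- The graph with vertices `V` and edges `E` has a tree decomposition of width at most `k`
in which one bag contains all of `I`. -/
def HasRootedTD (k : ℕ) (V I : ℕ → Prop) (E : ℕ → ℕ → Prop) : Prop :=
  ∃ (T : Type) (t : SimpleGraph T) (bag : T → Finset ℕ) (r : T), t.IsTree ∧
    (∀ i, I i → i ∈ bag r) ∧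
    (∀ x, ∀ i ∈ bag x, V i) ∧
    (∀ i, V i → ∃ x, i ∈ bag x) ∧
    (∀ i j, E i j → ∃ x, i ∈ bag x ∧ j ∈ bag x) ∧
    (∀ i x y, i ∈ bag x → i ∈ bag y → ∃ p : t.Walk x y, ∀ z ∈ p.support, i ∈ bag z) ∧
    (∀ x, (bag x).card ≤ k + 1)

namespace HasRootedTD

variable {k : ℕ} {V V₁ V₂ V₃ I I₁ I₂ I₃ : ℕ → Prop} {E E₁ E₂ E₃ : ℕ → ℕ → Prop}

theorem single (S : Finset ℕ) (hS : S.card ≤ k + 1) :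
    HasRootedTD k (· ∈ S) (· ∈ S) (fun i j => i ∈ S ∧ j ∈ S) :=
  ⟨Unit, ⊥, fun _ => S, (), .of_subsingleton, fun _ h => h, fun _ _ h => h, fun _ h => ⟨(), h⟩,
    fun _ _ h => ⟨(), h⟩, fun _ _ _ h _ => ⟨.nil, fun _ _ => h⟩, fun _ => hS⟩

theorem mono (h : HasRootedTD k V₁ I₁ E₁) (hV : ∀ i, V i ↔ V₁ i) (hI : ∀ i, I i → I₁ i)
    (hE : ∀ i j, E i j → E₁ i j) : HasRootedTD k V I E := by
  obtain ⟨T, t, bag, r, ht, h₁, h₂, h₃, h₄, h₅, h₆⟩ := h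
  exact ⟨T, t, bag, r, ht, fun i hi => h₁ i (hI i hi), fun x i hi => (hV i).2 (h₂ x i hi),
    fun i hi => h₃ i ((hV i).1 hi), fun i j hij => h₄ i j (hE i j hij), h₅, h₆⟩

theorem glue (h₁ : HasRootedTD k V₁ I₁ E₁) (h₂ : HasRootedTD k V₂ I₂ E₂)
    (h : ∀ i, V₁ i → V₂ i → I₁ i ∧ I₂ i) :
    HasRootedTD k (fun i => V₁ i ∨ V₂ i) I₁ (fun i j => E₁ i j ∨ E₂ i j) := by
  obtain ⟨T, t, bag, r, ht, hr, hb, hv, he, hc, hk⟩ := h₁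
  obtain ⟨T', t', bag', r', ht', hr', hb', hv', he', hc', hk'⟩ := h₂
  obtain ⟨G, f, g, hG, hf, hg, hadj⟩ := ht.exists_join ht' r r'
  have cross : ∀ i x y, i ∈ bag x → i ∈ bag' y → ∃ p : G.Walk (Sum.inl x) (Sum.inr y),
      ∀ z ∈ p.support, i ∈ Sum.elim bag bag' z := by
    intro i x y hx hy
    obtain ⟨hi, hi'⟩ := h i (hb _ _ hx) (hb' _ _ hy)
    obtain ⟨p, hp⟩ := hc i x r hx (hr i hi)
    obtain ⟨q, hq⟩ := hc' i r' y (hr' i hi') hy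
    refine ⟨((p.map f).copy (hf x) (hf r)).append (.cons hadj ((q.map g).copy (hg r') (hg y))),
      fun z hz => ?_⟩
    simp only [SimpleGraph.Walk.mem_support_append_iff, SimpleGraph.Walk.support_cons,
      List.mem_cons, SimpleGraph.Walk.support_copy, SimpleGraph.Walk.support_map, List.mem_map,
      hf, hg] at hz
    rcases hz with ⟨a, ha, rfl⟩ | rfl | ⟨a, ha, rfl⟩
    · exact hp a ha
    · exact hr i hi
    · exact hq a ha
  refine ⟨T ⊕ T', G, Sum.elim bag bag', Sum.inl r, hG, hr, ?_, ?_, ?_, ?_, ?_⟩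
  · rintro (x | x) i hi
    · exact .inl (hb x i hi)
    · exact .inr (hb' x i hi)
  · rintro i (hi | hi)
    · obtain ⟨x, hx⟩ := hv i hi
      exact ⟨.inl x, hx⟩
    · obtain ⟨x, hx⟩ := hv' i hi
      exact ⟨.inr x, hx⟩
  · rintro i j (hi | hi)
    · obtain ⟨x, hx⟩ := he i j hi
      exact ⟨.inl x, hx⟩
    · obtain ⟨x, hx⟩ := he' i j hi
      exact ⟨.inr x, hx⟩
  · rintro i (x | x) (y | y) hx hy
    · obtain ⟨p, hp⟩ := hc i x y hx hy
      refine ⟨(p.map f).copy (hf x) (hf y), fun z hz => ?_⟩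
      simp only [SimpleGraph.Walk.support_copy, SimpleGraph.Walk.support_map, List.mem_map,
        hf] at hz
      obtain ⟨a, ha, rfl⟩ := hz
      exact hp a ha
    · exact cross i x y hx hy
    · obtain ⟨p, hp⟩ := cross i y x hy hx
      exact ⟨p.reverse, fun z hz => hp z (by simpa using hz)⟩
    · obtain ⟨p, hp⟩ := hc' i x y hx hy
      refine ⟨(p.map g).copy (hg x) (hg y), fun z hz => ?_⟩
      simp only [SimpleGraph.Walk.support_copy, SimpleGraph.Walk.support_map, List.mem_map,
        hg] at hz
      obtain ⟨a, ha, rfl⟩ := hz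
      exact hp a ha
  · rintro (x | x)
    · exact hk x
    · exact hk' x

theorem star (S : Finset ℕ) (hS : S.card ≤ k + 1) (h₁ : HasRootedTD k V₁ I₁ E₁)
    (h₂ : HasRootedTD k V₂ I₂ E₂) (h₃ : HasRootedTD k V₃ I₃ E₃)
    (hV : ∀ i, V i ↔ i ∈ S ∨ V₁ i ∨ V₂ i ∨ V₃ i) (hI : ∀ i, I i → i ∈ S)
    (hE : ∀ i j, E i j → (i ∈ S ∧ j ∈ S) ∨ E₁ i j ∨ E₂ i j ∨ E₃ i j)
    (hS₁ : ∀ i ∈ S, V₁ i → I₁ i) (hS₂ : ∀ i ∈ S, V₂ i → I₂ i) (hS₃ : ∀ i ∈ S, V₃ i → I₃ i)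
    (h₁₂ : ∀ i, V₁ i → V₂ i → i ∈ S) (h₁₃ : ∀ i, V₁ i → V₃ i → i ∈ S)
    (h₂₃ : ∀ i, V₂ i → V₃ i → i ∈ S) : HasRootedTD k V I E := by
  refine ((((single S hS).glue h₁ ?_).glue h₂ ?_).glue h₃ ?_).mono ?_ hI ?_
  · exact fun i hi hi' => ⟨hi, hS₁ i hi hi'⟩
  · rintro i (hi | hi) hi'
    · exact ⟨hi, hS₂ i hi hi'⟩
    · exact ⟨h₁₂ i hi hi', hS₂ i (h₁₂ i hi hi') hi'⟩
  · rintro i ((hi | hi) | hi) hi'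
    · exact ⟨hi, hS₃ i hi hi'⟩
    · exact ⟨h₁₃ i hi hi', hS₃ i (h₁₃ i hi hi') hi'⟩
    · exact ⟨h₂₃ i hi hi', hS₃ i (h₂₃ i hi hi') hi'⟩
  · intro i
    rw [hV, or_assoc, or_assoc]
  · intro i j hij
    rw [or_assoc, or_assoc]
    exact hE i j hij

theorem hasTreewidthLE {S : Set ℕ} (h : HasRootedTD k V I E) (hS : ∀ i ∈ S, V i)
    {E' : ℕ → ℕ → Prop} (hE : ∀ i j, E' i j → E i j ∨ E j i) : HasTreewidthLE S E' k := by
  classical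
  obtain ⟨T, t, bag, r, ht, -, -, hv, he, hc, hk⟩ := h
  refine ⟨T, t, ht, bag, fun v hv' => hv v (hS v hv'), fun i j hij => ?_,
    fun v x y p hp hx hy z hz => ?_, hk⟩
  · rcases hE i j hij with h | h
    · exact he i j h
    · obtain ⟨x, hx⟩ := he j i h
      exact ⟨x, hx.symm⟩
  · obtain ⟨q, hq⟩ := hc v x y hx hy
    have hpq : p = q.bypass :=
      (ht.existsUnique_path x y).unique hp q.bypass_isPath
    exact hq z (q.support_bypass_subset_support (hpq ▸ hz))

end HasRootedTD

/-- The strict interiors of `[l₁, r₁]` and `[l₂, r₂]` are closed under `M1` and their union is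
closed under `M2`. -/
structure IsClosedBlock {n : ℕ} (M1 M2 : Matching n) (l₁ r₁ l₂ r₂ : ℕ) : Prop where
  le₁ : l₁ ≤ r₁
  le₁₂ : r₁ ≤ l₂
  le₂ : l₂ ≤ r₂
  closed₁ : ∀ x y, M1.rel x y → (l₁ < x ∧ x < r₁ ↔ l₁ < y ∧ y < r₁)
  closed₂ : ∀ x y, M1.rel x y → (l₂ < x ∧ x < r₂ ↔ l₂ < y ∧ y < r₂)
  closed : ∀ x y, M2.rel x y →
    ((l₁ < x ∧ x < r₁ ∨ l₂ < x ∧ x < r₂) ↔ (l₁ < y ∧ y < r₁ ∨ l₂ < y ∧ y < r₂))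

/-- The edges of the block with intervals `[l₁, r₁]` and `[l₂, r₂]`, oriented to the right:
successor edges within an interval, and arches between interior points. -/
def BlockEdge {n : ℕ} (M1 M2 : Matching n) (l₁ r₁ l₂ r₂ i j : ℕ) : Prop :=
  (j = i + 1 ∧ (l₁ ≤ i ∧ j ≤ r₁ ∨ l₂ ≤ i ∧ j ≤ r₂)) ∨
    ((M1.rel i j ∨ M2.rel i j) ∧ (l₁ < i ∧ i < r₁ ∨ l₂ < i ∧ i < r₂))

/-- The block with intervals `[l₁, r₁]` and `[l₂, r₂]` has a tree decomposition of width at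
most `11` with all four interval ends in one bag. -/
def BlockTD {n : ℕ} (M1 M2 : Matching n) (l₁ r₁ l₂ r₂ : ℕ) : Prop :=
  HasRootedTD 11 (fun i => l₁ ≤ i ∧ i ≤ r₁ ∨ l₂ ≤ i ∧ i ≤ r₂)
    (fun i => i = l₁ ∨ i = r₁ ∨ i = l₂ ∨ i = r₂) (BlockEdge M1 M2 l₁ r₁ l₂ r₂)

namespace Matching

variable {n : ℕ} (M : Matching n)

/-- Two arches are equal, or have no common end and do not cross. -/
theorem laminar {a b x y : ℕ} (h : M.rel a b) (h' : M.rel x y) :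
    a < b ∧ x < y ∧ (x = a ∧ y = b ∨ (x ≠ a ∧ x ≠ b ∧ y ≠ a ∧ y ≠ b ∧
      (a < x → x < b → y < b) ∧ (x < a → a < y → b < y))) := by
  have h₁ := M.ordered _ _ h
  have h₂ := M.ordered _ _ h'
  have h₃ := M.unique _ _ _ _ h h'
  have h₄ := M.noncrossing _ _ _ _ h h'
  have h₅ := M.noncrossing _ _ _ _ h' h
  omega

end Matching

theorem Finset.card_le_eight {α : Type*} [DecidableEq α] {a b c d e f g h : α} :
    ({a, b, c, d, e, f, g, h} : Finset α).card ≤ 8 :=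
  (Finset.card_insert_le _ _).trans
    (Nat.succ_le_succ ((Finset.card_insert_le _ _).trans (Nat.succ_le_succ Finset.card_le_six)))

namespace IsClosedBlock

variable {n : ℕ} {M1 M2 : Matching n} {l₁ r₁ l₂ r₂ a b c d : ℕ}

/-- In a closed block whose first interior point starts a wave, no `M1`-arch passes over
the last point of that wave. -/
theorem not_over (hB : IsClosedBlock M1 M2 l₁ r₁ l₂ r₂) (hW : IsWaveStructure M1 M2)
    (hr : l₁ + 1 < r₁) (hw : IsTwoWaveQuad M1 M2 (l₁ + 1) b c d) {x y : ℕ}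
    (hxy : M1.rel x y) : ¬(l₁ < x ∧ x < d ∧ d < y ∧ (y < r₁ ∨ l₂ < y ∧ y < r₂)) := by
  rintro ⟨hx, hxd, hdy, hy⟩
  obtain ⟨_, _, _, _, _, _, had⟩ := hw
  obtain ⟨a', b', c', d', ⟨h₁, h₂, h₃, -, -, -, had'⟩, h⟩ := hW.1 x y hxy
  have h₄ := M2.laminar had had'
  have h₅ := hB.closed _ _ had'
  have h₆ := hB.closed _ _ had
  have := hB.le₁
  have := hB.le₁₂
  rcases h with ⟨rfl, rfl⟩ | ⟨rfl, rfl⟩ <;> omega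

/-- An arch at the first interior point of a closed block belongs to a wave that starts there. -/
theorem exists_wave (hB : IsClosedBlock M1 M2 l₁ r₁ l₂ r₂) (hW : IsWaveStructure M1 M2)
    (hr : l₁ + 1 < r₁) {x y : ℕ} (hxy : M1.rel x y ∨ M2.rel x y)
    (h : x = l₁ + 1 ∨ y = l₁ + 1) : ∃ b c d, IsTwoWaveQuad M1 M2 (l₁ + 1) b c d := by
  have hq : ∃ i1 i2 i3 i4, IsTwoWaveQuad M1 M2 i1 i2 i3 i4 ∧
      (l₁ + 1 = i1 ∨ l₁ + 1 = i2 ∨ l₁ + 1 = i3 ∨ l₁ + 1 = i4) := by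
    rcases hxy with hxy | hxy
    · obtain ⟨i1, i2, i3, i4, hw, h'⟩ := hW.1 x y hxy
      exact ⟨i1, i2, i3, i4, hw, by omega⟩
    · obtain ⟨i1, i2, i3, i4, hw, h'⟩ := hW.2 x y hxy
      exact ⟨i1, i2, i3, i4, hw, by omega⟩
  obtain ⟨i1, i2, i3, i4, hw, h'⟩ := hq
  obtain ⟨h₁, h₂, h₃, h₁₂, h₃₄, h₂₃, h₁₄⟩ := hw
  have := hB.closed₁ _ _ h₁₂
  have := hB.closed₁ _ _ h₃₄
  have := hB.closed _ _ h₂₃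
  have := hB.closed _ _ h₁₄
  have := hB.le₁
  have := hB.le₁₂
  obtain rfl : i1 = l₁ + 1 := by omega
  exact ⟨i2, i3, i4, h₁, h₂, h₃, h₁₂, h₃₄, h₂₃, h₁₄⟩

theorem tail (hB : IsClosedBlock M1 M2 l₁ r₁ l₂ r₂) (hr : l₁ + 1 < r₁)
    (h : ∀ x y, M1.rel x y ∨ M2.rel x y → x ≠ l₁ + 1 ∧ y ≠ l₁ + 1) :
    IsClosedBlock M1 M2 (l₁ + 1) r₁ l₂ r₂ := by
  have e₁ := hB.le₁
  have e₁₂ := hB.le₁₂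
  refine ⟨by omega, e₁₂, hB.le₂, fun x y hxy => ?_, hB.closed₂, fun x y hxy => ?_⟩
  · have := hB.closed₁ _ _ hxy
    have := h x y (.inl hxy)
    omega
  · have := hB.closed _ _ hxy
    have := h x y (.inr hxy)
    omega

/-- The two `M1`-arches of a wave bound a closed block. -/
theorem of_wave (hw : IsTwoWaveQuad M1 M2 a b c d) : IsClosedBlock M1 M2 a b c d := by
  obtain ⟨h₁, h₂, h₃, h₁₂, h₃₄, h₂₃, h₁₄⟩ := hw
  refine ⟨h₁.le, h₂.le, h₃.le, fun x y hxy => ?_, fun x y hxy => ?_, fun x y hxy => ?_⟩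
  · have := M1.laminar h₁₂ hxy
    omega
  · have := M1.laminar h₃₄ hxy
    omega
  · have := M2.laminar h₁₄ hxy
    have := M2.laminar h₂₃ hxy
    omega

/-- An interval closed under both matchings is a closed block with trivial second interval. -/
theorem of_interval {l r : ℕ} (hlr : l ≤ r)
    (h : ∀ x y, M1.rel x y ∨ M2.rel x y → (l < x ∧ x < r ↔ l < y ∧ y < r)) :
    IsClosedBlock M1 M2 l r r r := by
  refine ⟨hlr, le_rfl, le_rfl, fun x y hxy => h x y (.inl hxy), fun x y hxy => by omega,
    fun x y hxy => ?_⟩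
  have := h x y (.inr hxy)
  omega

/-- A wave starting a block within its first interval encloses a closed interval. -/
theorem middle (hB : IsClosedBlock M1 M2 l₁ r₁ l₂ r₂) (hW : IsWaveStructure M1 M2)
    (hr : l₁ + 1 < r₁) (hw : IsTwoWaveQuad M1 M2 (l₁ + 1) b c d) (hd : d < r₁) :
    IsClosedBlock M1 M2 b c c c := by
  have hno := fun x y => hB.not_over hW hr hw (x := x) (y := y)
  obtain ⟨h₁, h₂, h₃, h₁₂, h₃₄, h₂₃, h₁₄⟩ := hw
  refine of_interval h₂.le ?_
  rintro x y (hxy | hxy)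
  · have := hno x y hxy
    have := M1.laminar h₁₂ hxy
    have := M1.laminar h₃₄ hxy
    have := hB.closed₁ _ _ hxy
    omega
  · have := M2.laminar h₂₃ hxy
    omega

/-- What follows a wave starting a block within its first interval is a closed block. -/
theorem after (hB : IsClosedBlock M1 M2 l₁ r₁ l₂ r₂) (hW : IsWaveStructure M1 M2)
    (hr : l₁ + 1 < r₁) (hw : IsTwoWaveQuad M1 M2 (l₁ + 1) b c d) (hd : d < r₁) :
    IsClosedBlock M1 M2 d r₁ l₂ r₂ := by
  have hno := fun x y => hB.not_over hW hr hw (x := x) (y := y)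
  obtain ⟨h₁, h₂, h₃, h₁₂, h₃₄, h₂₃, h₁₄⟩ := hw
  have e₁₂ := hB.le₁₂
  refine ⟨hd.le, e₁₂, hB.le₂, fun x y hxy => ?_, hB.closed₂, fun x y hxy => ?_⟩
  · have := hno x y hxy
    have := M1.laminar h₃₄ hxy
    have := hB.closed₁ _ _ hxy
    omega
  · have := M2.laminar h₁₄ hxy
    have := hB.closed _ _ hxy
    omega

/-- The part of a block enclosed by a wave that starts it and meets both intervals. -/
theorem between (hB : IsClosedBlock M1 M2 l₁ r₁ l₂ r₂) (hW : IsWaveStructure M1 M2)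
    (hr : l₁ + 1 < r₁) (hw : IsTwoWaveQuad M1 M2 (l₁ + 1) b c d) (hb : b < r₁)
    (hc : l₂ < c) (hd : d < r₂) :
    IsClosedBlock M1 M2 b r₁ l₂ c := by
  have hno := fun x y => hB.not_over hW hr hw (x := x) (y := y)
  obtain ⟨h₁, h₂, h₃, h₁₂, h₃₄, h₂₃, h₁₄⟩ := hw
  have e₁₂ := hB.le₁₂
  refine ⟨hb.le, e₁₂, hc.le, fun x y hxy => ?_, fun x y hxy => ?_, fun x y hxy => ?_⟩
  · have := M1.laminar h₁₂ hxy
    have := hB.closed₁ _ _ hxy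
    omega
  · have := hno x y hxy
    have := M1.laminar h₃₄ hxy
    have := hB.closed₂ _ _ hxy
    omega
  · have := M2.laminar h₂₃ hxy
    have := hB.closed _ _ hxy
    omega

/-- The part of a block after a wave that starts it and meets both intervals. -/
theorem afterCrossing (hB : IsClosedBlock M1 M2 l₁ r₁ l₂ r₂) (hW : IsWaveStructure M1 M2)
    (hr : l₁ + 1 < r₁) (hw : IsTwoWaveQuad M1 M2 (l₁ + 1) b c d) (hb : b < r₁)
    (hc : l₂ < c) (hd : d < r₂) :
    IsClosedBlock M1 M2 d r₂ r₂ r₂ := by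
  have hno := fun x y => hB.not_over hW hr hw (x := x) (y := y)
  obtain ⟨h₁, h₂, h₃, h₁₂, h₃₄, h₂₃, h₁₄⟩ := hw
  have e₁₂ := hB.le₁₂
  refine of_interval hd.le ?_
  rintro x y (hxy | hxy)
  · have := hno x y hxy
    have := M1.laminar h₃₄ hxy
    have := hB.closed₂ _ _ hxy
    omega
  · have := M2.laminar h₁₄ hxy
    have := hB.closed _ _ hxy
    omega

/-- Every closed block of a wave structure has a suitable tree decomposition. -/
theorem blockTD (hW : IsWaveStructure M1 M2) (m : ℕ) : ∀ l₁ r₁ l₂ r₂,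
    IsClosedBlock M1 M2 l₁ r₁ l₂ r₂ → r₁ - l₁ + (r₂ - l₂) ≤ m → BlockTD M1 M2 l₁ r₁ l₂ r₂ := by
  induction m using Nat.strong_induction_on with
  | _ m ih =>
  have trivialTD : ∀ l₁ r₁ l₂ r₂, IsClosedBlock M1 M2 l₁ r₁ l₂ r₂ → r₁ ≤ l₁ + 1 → r₂ ≤ l₂ + 1 →
      BlockTD M1 M2 l₁ r₁ l₂ r₂ := by
    intro l₁ r₁ l₂ r₂ hB hr₁ hr₂
    have e₁ := hB.le₁
    have e₂ := hB.le₂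
    refine (HasRootedTD.single {l₁, r₁, l₂, r₂}
      (Finset.card_le_four.trans (by norm_num))).mono ?_ ?_ ?_
    · intro i
      simp only [Finset.mem_insert, Finset.mem_singleton]
      omega
    · intro i
      simp only [Finset.mem_insert, Finset.mem_singleton]
      omega
    · intro i j hij
      simp only [Finset.mem_insert, Finset.mem_singleton]
      unfold BlockEdge at hij
      omega
  have firstTD : ∀ l₁ r₁ l₂ r₂, IsClosedBlock M1 M2 l₁ r₁ l₂ r₂ → r₁ - l₁ + (r₂ - l₂) ≤ m →
      l₁ + 1 < r₁ → BlockTD M1 M2 l₁ r₁ l₂ r₂ := by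
    intro l₁ r₁ l₂ r₂ hB hm hr
    have e₁₂ := hB.le₁₂
    have e₂ := hB.le₂
    by_cases hfree : ∀ x y, M1.rel x y ∨ M2.rel x y → x ≠ l₁ + 1 ∧ y ≠ l₁ + 1
    · have h := ih _ (by omega) _ _ _ _ (hB.tail hr hfree) le_rfl
      have hroot := HasRootedTD.single (k := 11) {l₁, l₁ + 1, r₁, l₂, r₂}
        (Finset.card_le_five.trans (by norm_num))
      refine (hroot.glue h ?_).mono ?_ ?_ ?_
      all_goals simp only [Finset.mem_insert, Finset.mem_singleton]
      · omega
      · omega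
      · omega
      · intro i j hij
        have := hfree i j
        unfold BlockEdge at hij ⊢
        by_cases hrel : M1.rel i j ∨ M2.rel i j
        · simp only [hrel, true_and, true_imp_iff] at *
          omega
        · simp only [hrel, false_and, or_false] at *
          omega
    · push Not at hfree
      obtain ⟨x, y, hxy, h⟩ := hfree
      obtain ⟨b, c, d, hw⟩ := hB.exists_wave hW hr hxy (by tauto)
      have hw' := hw
      obtain ⟨h₁, h₂, h₃, h₁₂, h₃₄, h₂₃, h₁₄⟩ := hw'
      have hb := hB.closed₁ _ _ h₁₂
      have hc := hB.closed₁ _ _ h₃₄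
      have hc' := hB.closed₂ _ _ h₃₄
      have hd := hB.closed _ _ h₁₄
      have hcard : ({l₁, l₁ + 1, b, c, d, r₁, l₂, r₂} : Finset ℕ).card ≤ 11 + 1 :=
        Finset.card_le_eight.trans (by norm_num)
      have hends : ∀ i j, M1.rel i j ∨ M2.rel i j → (i = l₁ + 1 ∧ (j = b ∨ j = d)) ∨
          (i = b ∧ j = c) ∨ (i = c ∧ j = d) ∨ (i ≠ l₁ + 1 ∧ i ≠ b ∧ i ≠ c ∧ i ≠ d) := by
        rintro i j (hij | hij)
        · have := M1.laminar h₁₂ hij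
          have := M1.laminar h₃₄ hij
          omega
        · have := M2.laminar h₁₄ hij
          have := M2.laminar h₂₃ hij
          omega
      by_cases hdr : d < r₁
      · clear hb hc hc' hd
        refine HasRootedTD.star _ hcard
          (ih _ (by omega) _ _ _ _ (of_wave hw) le_rfl)
          (ih _ (by omega) _ _ _ _ (hB.middle hW hr hw hdr) le_rfl)
          (ih _ (by omega) _ _ _ _ (hB.after hW hr hw hdr) le_rfl) ?_ ?_ ?_ ?_ ?_ ?_ ?_ ?_ ?_
        all_goals simp only [Finset.mem_insert, Finset.mem_singleton]
        case refine_3 =>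
          intro i j hij
          have := hends i j
          unfold BlockEdge at hij ⊢
          by_cases hrel : M1.rel i j ∨ M2.rel i j
          · simp only [hrel, true_and, true_imp_iff] at *
            grind
          · simp only [hrel, false_and, or_false] at *
            grind
        all_goals grind (splits := 20)
      · have hbr : b < r₁ := by omega
        have hlc : l₂ < c := by omega
        have hdr₂ : d < r₂ := by omega
        clear hb hc hc' hd hdr
        refine HasRootedTD.star _ hcard
          (ih _ (by omega) _ _ _ _ (of_wave hw) le_rfl)
          (ih _ (by omega) _ _ _ _ (hB.between hW hr hw hbr hlc hdr₂) le_rfl)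
          (ih _ (by omega) _ _ _ _ (hB.afterCrossing hW hr hw hbr hlc hdr₂) le_rfl)
          ?_ ?_ ?_ ?_ ?_ ?_ ?_ ?_ ?_
        all_goals simp only [Finset.mem_insert, Finset.mem_singleton]
        case refine_3 =>
          intro i j hij
          have := hends i j
          unfold BlockEdge at hij ⊢
          by_cases hrel : M1.rel i j ∨ M2.rel i j
          · simp only [hrel, true_and, true_imp_iff] at *
            grind
          · simp only [hrel, false_and, or_false] at *
            grind
        all_goals grind (splits := 20)
  intro l₁ r₁ l₂ r₂ hB hm
  by_cases hr₁ : l₁ + 1 < r₁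
  · exact firstTD _ _ _ _ hB hm hr₁
  by_cases hr₂ : l₂ + 1 < r₂
  · have e₁ := hB.le₁
    have e₁₂ := hB.le₁₂
    have hB₂ : IsClosedBlock M1 M2 l₂ r₂ r₂ r₂ := by
      refine of_interval hB.le₂ ?_
      rintro x y (hxy | hxy)
      · exact hB.closed₂ x y hxy
      · have := hB.closed x y hxy
        omega
    have h := firstTD _ _ _ _ hB₂ (by omega) hr₂
    have hroot := HasRootedTD.single (k := 11) {l₁, r₁, l₂, r₂}
      (Finset.card_le_four.trans (by norm_num))
    refine (hroot.glue h ?_).mono ?_ ?_ ?_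
    all_goals simp only [Finset.mem_insert, Finset.mem_singleton]
    · omega
    · omega
    · omega
    · intro i j hij
      unfold BlockEdge at hij ⊢
      by_cases hrel : M1.rel i j ∨ M2.rel i j
      · simp only [hrel, true_and] at *
        omega
      · simp only [hrel, false_and, or_false] at *
        omega
  · exact trivialTD _ _ _ _ hB (by omega) (by omega)

end IsClosedBlock

/-- Every 2-wave word has treewidth at most 11. -/
theorem wave_word_treewidth_le_eleven (α : Type) [Finite α] (ω : TwoNW α)
    (hω : ω.IsWaveWord) :
    HasTreewidthLE (Set.Icc 1 ω.word.length) ω.Adj 11 := by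
  set n := ω.word.length with hn
  have hB : IsClosedBlock ω.M1 ω.M2 0 (n + 1) (n + 1) (n + 1) := by
    refine .of_interval (Nat.zero_le _) ?_
    rintro x y (hxy | hxy)
    · have := ω.M1.ordered x y hxy
      omega
    · have := ω.M2.ordered x y hxy
      omega
  have h := IsClosedBlock.blockTD hω _ _ _ _ _ hB le_rfl
  refine HasRootedTD.hasTreewidthLE h ?_ ?_
  · intro i hi
    have := Set.mem_Icc.1 hi
    omega
  · intro i j hij
    unfold BlockEdge
    rcases hij with hij | hij | hij | hij | hij | hij
    · have := ω.M1.ordered _ _ hij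
      exact .inl (.inr ⟨.inl hij, by omega⟩)
    · have := ω.M1.ordered _ _ hij
      exact .inr (.inr ⟨.inl hij, by omega⟩)
    · have := ω.M2.ordered _ _ hij
      exact .inl (.inr ⟨.inr hij, by omega⟩)
    · have := ω.M2.ordered _ _ hij
      exact .inr (.inr ⟨.inr hij, by omega⟩)
    · exact .inl (.inl (by omega))
    · exact .inr (.inl (by omega))
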